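/- arXiv:2209.07592 — 2 statements merged into one kernel-verified Lean document; each statement's English description precedes it below -/
import Mathlib

section
/- For every p ∈ [1, ∞] with dual exponent q (1/p + 1/q = 1), every ε ≥ 0, every θ, x ∈ ℝᵐ and y ∈ ℝ, the supremum of (y − ⟨x + δ, θ⟩)² over all perturbations δ ∈ ℝᵐ with ‖δ‖_p ≤ ε equals (|y − ⟨x, θ⟩| + ε·‖θ‖_q)², and this supremum is attained by some admissible δ. -/
open scoped Matrix ENNReal

/-- The `ℓ_p` norm of a vector in `ℝᵐ`, via Mathlib's `PiLp` norm. -/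
noncomputable def lpNorm {m : ℕ} (p : ℝ≥0∞) (x : Fin m → ℝ) : ℝ :=
  ‖(WithLp.equiv p (Fin m → ℝ)).symm x‖

theorem lpNorm_one {m : ℕ} (x : Fin m → ℝ) : lpNorm 1 x = ∑ i, |x i| := by
  simp [lpNorm, PiLp.norm_eq_sum (p := 1) (by simp)]

theorem lpNorm_top {m : ℕ} (x : Fin m → ℝ) : lpNorm ∞ x = ⨆ i, |x i| := by
  simp [lpNorm, PiLp.norm_eq_ciSup]

theorem abs_apply_le_lpNorm_top {m : ℕ} (x : Fin m → ℝ) (i : Fin m) : |x i| ≤ lpNorm ∞ x := by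
  rw [lpNorm_top]
  exact le_ciSup (f := fun i ↦ |x i|) (Set.finite_range _).bddAbove i

theorem lpNorm_eq_sum {m : ℕ} {p : ℝ≥0∞} (hp : 0 < p.toReal) (x : Fin m → ℝ) :
    lpNorm p x = (∑ i, |x i| ^ p.toReal) ^ (1 / p.toReal) := by
  simp [lpNorm, PiLp.norm_eq_sum hp]

theorem lpNorm_smul {m : ℕ} {p : ℝ≥0∞} (hp : 1 ≤ p) (c : ℝ) (x : Fin m → ℝ) :
    lpNorm p (c • x) = |c| * lpNorm p x := by
  have : Fact (1 ≤ p) := ⟨hp⟩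
  simp [lpNorm, norm_smul]

theorem lpNorm_nonneg {m : ℕ} {p : ℝ≥0∞} (hp : 1 ≤ p) (x : Fin m → ℝ) : 0 ≤ lpNorm p x := by
  have : Fact (1 ≤ p) := ⟨hp⟩
  exact norm_nonneg _

theorem abs_dotProduct_le_lpNorm_one_mul_lpNorm_top {m : ℕ} (u v : Fin m → ℝ) :
    |u ⬝ᵥ v| ≤ lpNorm 1 u * lpNorm ∞ v := by
  rw [lpNorm_one, Finset.sum_mul]
  refine (Finset.abs_sum_le_sum_abs _ _).trans (Finset.sum_le_sum fun i _ ↦ ?_)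
  rw [abs_mul]
  exact mul_le_mul_of_nonneg_left (abs_apply_le_lpNorm_top v i) (abs_nonneg _)

/-- Hölder's inequality for the dot product. -/
theorem abs_dotProduct_le_lpNorm_mul_lpNorm {m : ℕ} (p q : ℝ≥0∞) [p.HolderConjugate q]
    (u v : Fin m → ℝ) : |u ⬝ᵥ v| ≤ lpNorm p u * lpNorm q v := by
  obtain rfl | hp := eq_or_ne p ∞
  · obtain rfl := ENNReal.HolderConjugate.unique ∞ q 1
    rw [dotProduct_comm, mul_comm]
    exact abs_dotProduct_le_lpNorm_one_mul_lpNorm_top v u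
  obtain rfl | hq := eq_or_ne q ∞
  · obtain rfl := ENNReal.HolderConjugate.unique ∞ p 1
    exact abs_dotProduct_le_lpNorm_one_mul_lpNorm_top u v
  have h := ENNReal.HolderConjugate.toReal_of_ne_top hp hq
  rw [lpNorm_eq_sum h.pos, lpNorm_eq_sum h.symm.pos]
  refine (Finset.abs_sum_le_sum_abs _ _).trans ?_
  simpa [abs_mul] using
    Real.inner_le_Lp_mul_Lq Finset.univ (fun i ↦ |u i|) (fun i ↦ |v i|) h

theorem abs_sign_le_one (a : ℝ) : |(SignType.sign a : ℝ)| ≤ 1 := by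
  rcases lt_trichotomy a 0 with h | rfl | h <;> simp [*]

/-- The `ℓ_q` norm is attained by pairing with a vector in the unit ball of the dual norm. -/
theorem exists_lpNorm_le_one_dotProduct_eq {m : ℕ} (p q : ℝ≥0∞) [p.HolderConjugate q]
    (v : Fin m → ℝ) : ∃ u, lpNorm p u ≤ 1 ∧ u ⬝ᵥ v = lpNorm q v := by
  obtain rfl | hp := eq_or_ne p ∞
  · obtain rfl := ENNReal.HolderConjugate.unique ∞ q 1
    refine ⟨fun i ↦ SignType.sign (v i), ?_, ?_⟩
    · rw [lpNorm_top]
      exact Real.iSup_le (fun i ↦ abs_sign_le_one _) zero_le_one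
    · simp [lpNorm_one, dotProduct, sign_mul_self]
  obtain rfl | hq := eq_or_ne q ∞
  · obtain rfl := ENNReal.HolderConjugate.unique ∞ p 1
    cases isEmpty_or_nonempty (Fin m)
    · exact ⟨0, by simp [lpNorm_one], by simp [lpNorm_top]⟩
    obtain ⟨i, hi⟩ := exists_eq_ciSup_of_finite (f := fun i ↦ |v i|)
    refine ⟨Pi.single i (SignType.sign (v i)), ?_, ?_⟩
    · rw [lpNorm_one, Finset.sum_eq_single i]
      · simpa using abs_sign_le_one (v i)
      · intro j _ hj
        simp [hj]
      · simp
    · rw [lpNorm_top, ← hi, single_dotProduct, sign_mul_self]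
  have h := ENNReal.HolderConjugate.toReal_of_ne_top hp hq
  obtain ⟨g, hg, hgv⟩ := (NNReal.isGreatest_Lp Finset.univ (fun i ↦ ‖v i‖₊) h.symm).1
  have hg' : ∑ i, (g i : ℝ) ^ p.toReal ≤ 1 := mod_cast hg
  have hgv' : ∑ i, |v i| * g i = (∑ i, |v i| ^ q.toReal) ^ (1 / q.toReal) := by
    simpa using congrArg NNReal.toReal hgv
  refine ⟨fun i ↦ SignType.sign (v i) * g i, ?_, ?_⟩
  · rw [lpNorm_eq_sum h.pos]
    refine Real.rpow_le_one (by positivity) (le_trans ?_ hg') h.one_div_nonneg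
    refine Finset.sum_le_sum fun i _ ↦
      Real.rpow_le_rpow (abs_nonneg _) ?_ h.nonneg
    rw [abs_mul, NNReal.abs_eq]
    exact mul_le_of_le_one_left (g i).2 (abs_sign_le_one _)
  · rw [lpNorm_eq_sum h.symm.pos, ← hgv']
    refine Finset.sum_congr rfl fun i _ ↦ ?_
    rw [mul_right_comm, sign_mul_self]

/-- For `p ∈ [1,∞]` with dual exponent `q`, `ε ≥ 0`, `θ, x ∈ ℝᵐ` and `y ∈ ℝ`, the supremum of
`(y − ⟨x + δ, θ⟩)²` over all `δ` with `‖δ‖_p ≤ ε` equals `(|y − ⟨x, θ⟩| + ε·‖θ‖_q)²`,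
and this supremum is attained by an admissible `δ`. -/
theorem adv_sup_eq {m : ℕ} (hm : 0 < m) (p q : ℝ≥0∞) (hp : 1 ≤ p)
    (hpq : 1 / p + 1 / q = 1) (ε : ℝ) (hε : 0 ≤ ε) (θ x : Fin m → ℝ) (y : ℝ) :
    sSup {z : ℝ | ∃ δ : Fin m → ℝ, lpNorm p δ ≤ ε ∧ z = (y - (x + δ) ⬝ᵥ θ) ^ 2}
        = (|y - x ⬝ᵥ θ| + ε * lpNorm q θ) ^ 2 ∧
      ∃ δ : Fin m → ℝ, lpNorm p δ ≤ ε ∧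
        (y - (x + δ) ⬝ᵥ θ) ^ 2 = (|y - x ⬝ᵥ θ| + ε * lpNorm q θ) ^ 2 := by
  have hpq' : p.HolderConjugate q := by
    rw [ENNReal.holderConjugate_iff]
    simpa using hpq
  have hq : 1 ≤ q := ENNReal.HolderConjugate.one_le q p
  have hattain : ∃ δ : Fin m → ℝ, lpNorm p δ ≤ ε ∧
      (y - (x + δ) ⬝ᵥ θ) ^ 2 = (|y - x ⬝ᵥ θ| + ε * lpNorm q θ) ^ 2 := by
    obtain ⟨u, hu, huθ⟩ := exists_lpNorm_le_one_dotProduct_eq p q θ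
    have hball (c : ℝ) (hc : |c| = ε) : lpNorm p (c • u) ≤ ε := by
      rw [lpNorm_smul hp, hc]
      exact mul_le_of_le_one_right hε hu
    rcases le_total 0 (y - x ⬝ᵥ θ) with hr | hr
    · refine ⟨(-ε) • u, hball _ (by simpa using hε), ?_⟩
      rw [add_dotProduct, smul_dotProduct, huθ, smul_eq_mul, abs_of_nonneg hr]
      ring
    · refine ⟨ε • u, hball _ (abs_of_nonneg hε), ?_⟩
      rw [add_dotProduct, smul_dotProduct, huθ, smul_eq_mul, abs_of_nonpos hr]
      ring
  refine ⟨IsGreatest.csSup_eq ⟨?_, ?_⟩, hattain⟩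
  · obtain ⟨δ, hδ, h⟩ := hattain
    exact ⟨δ, hδ, h.symm⟩
  · rintro _ ⟨δ, hδ, rfl⟩
    rw [← sq_abs, add_dotProduct, ← sub_sub]
    gcongr
    calc |y - x ⬝ᵥ θ - δ ⬝ᵥ θ| ≤ |y - x ⬝ᵥ θ| + |δ ⬝ᵥ θ| := abs_sub _ _
      _ ≤ |y - x ⬝ᵥ θ| + lpNorm p δ * lpNorm q θ := by
        gcongr
        exact abs_dotProduct_le_lpNorm_mul_lpNorm p q δ θ
      _ ≤ |y - x ⬝ᵥ θ| + ε * lpNorm q θ := by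
        gcongr
        exact lpNorm_nonneg hq θ
end

section
/- Under the Gaussian linear-regression model, for every p ∈ [1, ∞] with dual exponent q and every ε ≥ 0, the adversarial loss θ ↦ L_{p,ε}(θ) is a convex function on ℝᵐ; equivalently, θ ↦ c₂·σ_θ² + (c₁·σ_θ + ε·‖θ‖_q)² is convex, where c₁ = √(2/π) and c₂ = 1 − c₁². -/
open MeasureTheory ProbabilityTheory
open scoped Matrix ENNReal

/-- A random vector `X : Ω → ℝᵐ` has the centered multivariate Gaussian law `N(0, S)`
(with `S` positive semidefinite) iff every linear functional of it is a centered real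
Gaussian with the corresponding variance. -/
def HasCenteredGaussianLaw {Ω : Type*} [MeasurableSpace Ω] (μ : Measure Ω) {m : ℕ}
    (X : Ω → Fin m → ℝ) (S : Matrix (Fin m) (Fin m) ℝ) : Prop :=
  ∀ a : Fin m → ℝ,
    Measure.map (fun ω => X ω ⬝ᵥ a) μ = gaussianReal 0 (a ⬝ᵥ S.mulVec a).toNNReal

/-- For fixed `θ`, the squared residual maximised over an `ℓ_p` ball is attained, and it equals
`(|r| + K)²` where `K` is the maximum of `δ ⬝ᵥ θ` over the ball. -/
theorem exists_isGreatest_sq_sub_dotProduct {m : ℕ} {p : ℝ≥0∞} (hp : 1 ≤ p) {ε : ℝ} (hε : 0 ≤ ε)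
    (θ : Fin m → ℝ) :
    ∃ K : ℝ, ∀ x : Fin m → ℝ, ∀ y : ℝ,
      IsGreatest {z : ℝ | ∃ δ : Fin m → ℝ, lpNorm p δ ≤ ε ∧ z = (y - (x + δ) ⬝ᵥ θ) ^ 2}
        ((|y - x ⬝ᵥ θ| + K) ^ 2) := by
  have : Fact (1 ≤ p) := ⟨hp⟩
  obtain ⟨d, hd, hmax⟩ := (isCompact_closedBall (0 : PiLp p fun _ : Fin m => ℝ) ε).exists_isMaxOn
    ⟨0, by simpa using hε⟩
    (f := fun d => WithLp.ofLp d ⬝ᵥ θ) (by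
      refine Continuous.continuousOn ?_
      unfold dotProduct
      fun_prop)
  have hle : ∀ δ : Fin m → ℝ, lpNorm p δ ≤ ε → δ ⬝ᵥ θ ≤ WithLp.ofLp d ⬝ᵥ θ := fun δ hδ =>
    hmax (a := WithLp.toLp p δ) (by simpa [_root_.lpNorm] using hδ)
  have hneg : ∀ δ : Fin m → ℝ, lpNorm p δ ≤ ε → lpNorm p (-δ) ≤ ε := fun δ hδ => by
    simpa [_root_.lpNorm] using hδ
  have hdε : lpNorm p (WithLp.ofLp d) ≤ ε := by simpa [_root_.lpNorm] using hd
  refine ⟨WithLp.ofLp d ⬝ᵥ θ, fun x y => ⟨?_, ?_⟩⟩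
  · rcases le_total 0 (y - x ⬝ᵥ θ) with h | h
    · refine ⟨-WithLp.ofLp d, hneg _ hdε, ?_⟩
      rw [abs_of_nonneg h, add_dotProduct, neg_dotProduct]
      ring
    · refine ⟨WithLp.ofLp d, hdε, ?_⟩
      rw [abs_of_nonpos h, add_dotProduct]
      ring
  · rintro z ⟨δ, hδ, rfl⟩
    have h1 := hle δ hδ
    have h2 := hle (-δ) (hneg δ hδ)
    rw [neg_dotProduct] at h2
    rw [add_dotProduct]
    apply sq_le_sq'
    · linarith [neg_abs_le (y - x ⬝ᵥ θ)]
    · linarith [le_abs_self (y - x ⬝ᵥ θ)]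

/-- A random variable with real Gaussian law is square integrable. -/
theorem memLp_two_of_map_eq_gaussianReal {Ω : Type*} [MeasurableSpace Ω] {μ : Measure Ω}
    {f : Ω → ℝ} (hf : Measurable f) {a : ℝ} {v : NNReal} (h : Measure.map f μ = gaussianReal a v) :
    MemLp f 2 μ := by
  have h2 : MemLp id 2 (Measure.map f μ) := h ▸ memLp_id_gaussianReal 2
  exact h2.comp_of_map hf.aemeasurable

theorem convexOn_lpNorm {m : ℕ} {q : ℝ≥0∞} (hq : 1 ≤ q) :
    ConvexOn ℝ Set.univ (lpNorm q : (Fin m → ℝ) → ℝ) := by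
  have : Fact (1 ≤ q) := ⟨hq⟩
  exact convexOn_univ_norm.comp_linearMap
    (WithLp.linearEquiv q ℝ (Fin m → ℝ)).symm.toLinearMap

/-- The standard deviation of the residual is a convex function of the parameter. -/
theorem convexOn_sqrt_quadForm_add_sq {m : ℕ} {S : Matrix (Fin m) (Fin m) ℝ}
    (hS : S.PosSemidef) (c : Fin m → ℝ) (w : ℝ) :
    ConvexOn ℝ Set.univ (fun θ : Fin m → ℝ =>
      Real.sqrt ((θ - c) ⬝ᵥ S.mulVec (θ - c) + w ^ 2)) := by
  obtain ⟨B, rfl⟩ : ∃ B : Matrix (Fin m) (Fin m) ℝ, S = Bᴴ * B := by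
    open scoped MatrixOrder in
    exact CStarAlgebra.nonneg_iff_eq_star_mul_self.mp hS.nonneg
  let g : (Fin m → ℝ) → WithLp 2 (EuclideanSpace ℝ (Fin m) × ℝ) := fun θ =>
    WithLp.toLp 2 (WithLp.toLp 2 (B.mulVec (θ - c)), w)
  have hg : ∀ θ, Real.sqrt ((θ - c) ⬝ᵥ (Bᴴ * B).mulVec (θ - c) + w ^ 2) = ‖g θ‖ := by
    intro θ
    rw [WithLp.prod_norm_eq_of_L2]
    simp only [g, EuclideanSpace.real_norm_sq_eq, Real.norm_eq_abs, sq_abs]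
    rw [← Matrix.mulVec_mulVec, Matrix.dotProduct_mulVec, Matrix.conjTranspose_eq_transpose_of_trivial,
      Matrix.vecMul_transpose]
    simp [dotProduct, sq]
  simp only [hg]
  refine ⟨convex_univ, fun x _ y _ a b ha hb hab => ?_⟩
  have : g (a • x + b • y) = a • g x + b • g y := by
    have hc : a • x + b • y - c = a • (x - c) + b • (y - c) := by
      rw [smul_sub, smul_sub, sub_add_sub_comm, ← add_smul, hab, one_smul]
    simp only [g, hc, Matrix.mulVec_add, Matrix.mulVec_smul, ← WithLp.toLp_smul, ← WithLp.toLp_add,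
      Prod.smul_mk, Prod.mk_add_mk, smul_eq_mul, ← add_mul, hab, one_mul]
  beta_reduce
  rw [this]
  refine (norm_add_le _ _).trans_eq ?_
  rw [norm_smul, norm_smul, Real.norm_of_nonneg ha, Real.norm_of_nonneg hb]
  rfl

/-- In the Gaussian linear-regression model, for every `p ∈ [1,∞]` with dual exponent `q`
and every `ε ≥ 0`, the adversarial loss `θ ↦ L_{p,ε}(θ)` is convex on `ℝᵐ`; equivalently,
`θ ↦ c₂·σ_θ² + (c₁·σ_θ + ε·‖θ‖_q)²` is convex, where `c₁ = √(2/π)`, `c₂ = 1 − c₁²` and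
`σ_θ = sqrt((θ − θopt)ᵀ Σ (θ − θopt) + σ_w²)`. -/
theorem adv_loss_convex {Ω : Type*} [MeasurableSpace Ω]
    (μ : Measure Ω) [IsProbabilityMeasure μ] {m : ℕ} (hm : 0 < m)
    (S : Matrix (Fin m) (Fin m) ℝ) (hS : S.PosSemidef)
    (θopt : Fin m → ℝ) (σw : ℝ) (hσw : 0 < σw)
    (X : Ω → Fin m → ℝ) (hXmeas : Measurable X)
    (W : Ω → ℝ) (hWmeas : Measurable W)
    (hX : HasCenteredGaussianLaw μ X S)
    (hW : Measure.map W μ = gaussianReal 0 ⟨σw ^ 2, sq_nonneg σw⟩)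
    (hindep : IndepFun X W μ)
    (Y : Ω → ℝ) (hY : ∀ ω, Y ω = X ω ⬝ᵥ θopt + W ω)
    (p q : ℝ≥0∞) (hp : 1 ≤ p) (hpq : 1 / p + 1 / q = 1)
    (ε : ℝ) (hε : 0 ≤ ε) :
    ConvexOn ℝ Set.univ
        (fun θ : Fin m → ℝ =>
          ∫ ω, sSup {z : ℝ | ∃ δ : Fin m → ℝ,
            lpNorm p δ ≤ ε ∧ z = (Y ω - (X ω + δ) ⬝ᵥ θ) ^ 2} ∂μ) ∧
      ConvexOn ℝ Set.univ
        (fun θ : Fin m → ℝ =>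
          (1 - Real.sqrt (2 / Real.pi) ^ 2)
              * Real.sqrt ((θ - θopt) ⬝ᵥ S.mulVec (θ - θopt) + σw ^ 2) ^ 2
            + (Real.sqrt (2 / Real.pi)
                  * Real.sqrt ((θ - θopt) ⬝ᵥ S.mulVec (θ - θopt) + σw ^ 2)
                + ε * lpNorm q θ) ^ 2) := by
  constructor
  · choose K hK using fun θ : Fin m → ℝ => exists_isGreatest_sq_sub_dotProduct hp hε θ
    have hint : ∀ θ : Fin m → ℝ,
        Integrable (fun ω => (|Y ω - X ω ⬝ᵥ θ| + K θ) ^ 2) μ := by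
      intro θ
      have hXm : Measurable (fun ω => X ω ⬝ᵥ (θopt - θ)) := by
        unfold dotProduct
        fun_prop
      have h1 : MemLp (fun ω => Y ω - X ω ⬝ᵥ θ) 2 μ := by
        convert (memLp_two_of_map_eq_gaussianReal hXm (hX (θopt - θ))).add
          (memLp_two_of_map_eq_gaussianReal hWmeas hW) using 1
        ext ω
        simp only [Pi.add_apply, hY, dotProduct_sub]
        ring
      exact (h1.abs.add (memLp_const (K θ))).integrable_sq
    simp only [fun θ ω => (hK θ (X ω) (Y ω)).csSup_eq]
    refine ⟨convex_univ, fun x _ y _ a b ha hb hab => ?_⟩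
    simp only [smul_eq_mul]
    rw [← integral_const_mul, ← integral_const_mul,
      ← integral_add ((hint x).const_mul a) ((hint y).const_mul b)]
    refine integral_mono (hint _) (((hint x).const_mul a).add ((hint y).const_mul b)) fun ω => ?_
    obtain ⟨δ, hδ, hz⟩ := (hK (a • x + b • y) (X ω) (Y ω)).1
    have hx := (hK x (X ω) (Y ω)).2 ⟨δ, hδ, rfl⟩
    have hy := (hK y (X ω) (Y ω)).2 ⟨δ, hδ, rfl⟩
    have hlin : Y ω - (X ω + δ) ⬝ᵥ (a • x + b • y)
        = a • (Y ω - (X ω + δ) ⬝ᵥ x) + b • (Y ω - (X ω + δ) ⬝ᵥ y) := by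
      simp only [dotProduct_add, dotProduct_smul, smul_eq_mul]
      linear_combination -Y ω * hab
    change (|Y ω - X ω ⬝ᵥ (a • x + b • y)| + K (a • x + b • y)) ^ 2
      ≤ a * (|Y ω - X ω ⬝ᵥ x| + K x) ^ 2 + b * (|Y ω - X ω ⬝ᵥ y| + K y) ^ 2
    rw [hz, hlin]
    exact ((even_two.convexOn_pow (𝕜 := ℝ)).2 trivial trivial ha hb hab).trans
      (add_le_add (mul_le_mul_of_nonneg_left hx ha) (mul_le_mul_of_nonneg_left hy hb))
  · have hq : 1 ≤ q := by
      have h : 1 / q ≤ 1 := le_add_self.trans_eq hpq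
      simpa using h
    have : Fact (1 ≤ q) := ⟨hq⟩
    have hc : 0 ≤ 1 - Real.sqrt (2 / Real.pi) ^ 2 := by
      rw [Real.sq_sqrt (by positivity), sub_nonneg, div_le_one Real.pi_pos]
      exact Real.two_le_pi
    have hσ := convexOn_sqrt_quadForm_add_sq hS θopt σw
    have hn : ∀ θ : Fin m → ℝ, 0 ≤ lpNorm q θ := fun θ => norm_nonneg _
    refine ((hσ.pow (fun θ _ => Real.sqrt_nonneg _) 2).smul hc).add
      (((hσ.smul (Real.sqrt_nonneg _)).add ((convexOn_lpNorm hq).smul hε)).pow (fun θ _ => ?_) 2)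
    have := hn θ
    simp only [Pi.add_apply, smul_eq_mul]
    positivity
end
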